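/- (Theorem A(b)) Assume R is not Gorenstein (equivalently, r ≥ 2). If there exists a non-zero minimal acyclic complex A of finitely generated free R-modules, then e = r + 1; in particular the length of R as a module over itself is ℓ_R(R) = 2e. -/

import Mathlib

open IsLocalRing CategoryTheory

/-- The length of an `R`-module `M`: the supremum of the lengths of strictly increasing
chains of submodules of `M`.  For a module annihilated by the maximal ideal of a local
ring this coincides with the dimension over the residue field `k`. -/
noncomputable def moduleLength (R M : Type) [Ring R] [AddCommGroup M] [Module R M] : ℕ∞ :=
  ⨆ p : LTSeries (Submodule R M), (p.length : ℕ∞)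

/-- `Ext^n_R(M, N)`, as an object of `ModuleCat R`. -/
noncomputable def extModule (R : Type) [CommRing R] (M N : Type) [AddCommGroup M] [Module R M]
    [AddCommGroup N] [Module R N] (n : ℕ) : ModuleCat R :=
  ((Ext R (ModuleCat R) n).obj (Opposite.op (ModuleCat.of R M))).obj (ModuleCat.of R N)

/-- The `i`-th Betti number `β_i^R(M) = dim_k Ext^i_R(M, k)` of a module `M` over a local
ring `(R, m, k)`, computed as the length over `R` of `Ext^i_R(M, k)` (an `R`-module
annihilated by `m`, hence a `k`-vector space). -/
noncomputable def bettiNum (R : Type) [CommRing R] [IsLocalRing R] (M : Type) [AddCommGroup M]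
    [Module R M] (i : ℕ) : ℕ∞ :=
  moduleLength R (extModule R M (ResidueField R) i).carrier

/-- The `i`-th Bass number `μ^i_R = dim_k Ext^i_R(k, R)` of a local ring `(R, m, k)`. -/
noncomputable def bassNum (R : Type) [CommRing R] [IsLocalRing R] (i : ℕ) : ℕ∞ :=
  moduleLength R (extModule R (ResidueField R) R i).carrier

/-- The socle `Soc R = (0 :_R m)` of a local ring `(R, m)`. -/
noncomputable def socle (R : Type) [CommRing R] [IsLocalRing R] : Ideal R :=
  Submodule.colon (⊥ : Ideal R) (maximalIdeal R)

/-- The socle dimension `r = dim_k (0 :_R m)` of a local ring `(R, m, k)`. -/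
noncomputable def socdim (R : Type) [CommRing R] [IsLocalRing R] : ℕ∞ :=
  moduleLength R (socle R)

/-- The embedding dimension `e = dim_k (m/m²)` of a local ring `(R, m, k)`. -/
noncomputable def embdim (R : Type) [CommRing R] [IsLocalRing R] : ℕ∞ :=
  moduleLength R (CotangentSpace R)

/-- The residue field `k` is (isomorphic to) a direct summand of the `R`-module `M`,
expressed by a split injection `k → M`. -/
def kSummand (R : Type) [CommRing R] [IsLocalRing R] (M : Type) [AddCommGroup M]
    [Module R M] : Prop :=
  ∃ (f : M →ₗ[R] ResidueField R) (g : ResidueField R →ₗ[R] M), f ∘ₗ g = LinearMap.id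

/-- Vanishing of the `i`-th homology of the dual complex `A* = Hom_R(A, R)` of a chain
complex `A` with differentials `d i : A (i+1) → A i` (so that `∂_j = d (j-1)`):
every functional on `A_i` vanishing on the image of `∂_{i+1}` factors through `∂_i`.
(The index `i` is written as `i - 1 + 1` for type-checking reasons.)  Together with the
automatic inclusion `im ∂*_i ⊆ ker ∂*_{i+1}`, this says exactly `H_i(A*) = 0`. -/
def dualHomologyIsZero (R : Type) [CommRing R] (A : ℤ → Type) [∀ i, AddCommGroup (A i)]
    [∀ i, Module R (A i)] (d : ∀ i : ℤ, A (i + 1) →ₗ[R] A i) (i : ℤ) : Prop :=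
  ∀ f : A (i - 1 + 1) →ₗ[R] R, f ∘ₗ d (i - 1 + 1) = 0 →
    ∃ g : A (i - 1) →ₗ[R] R, f = g ∘ₗ d (i - 1)


/-- `M` is a retract (direct summand up to isomorphism) of `N`. -/
def IsRetr (R : Type) [CommRing R] (M N : Type) [AddCommGroup M] [Module R M]
    [AddCommGroup N] [Module R N] : Prop :=
  ∃ (i : M →ₗ[R] N) (p : N →ₗ[R] M), p ∘ₗ i = LinearMap.id

theorem moduleLength_eq (R M : Type) [Ring R] [AddCommGroup M] [Module R M] :
    moduleLength R M = Module.length R M := by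
  apply WithBot.coe_injective
  rw [Module.coe_length, Order.krullDim_eq_iSup_length]
  rfl

theorem len_smul_top {R : Type} [CommRing R] [Nontrivial R] (I : Ideal R) (F : Type) [AddCommGroup F]
    [Module R F] [Module.Free R F] [Module.Finite R F] :
    Module.length R (I • (⊤ : Submodule R F) : Submodule R F)
      = (Module.finrank R F : ℕ∞) * Module.length R I := by
  let b := Module.finBasis R F
  let φ : (Fin (Module.finrank R F) → I) →ₗ[R] F :=
    b.equivFun.symm.toLinearMap ∘ₗ LinearMap.pi (fun i => I.subtype ∘ₗ LinearMap.proj i)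
  have hinj : Function.Injective φ := by
    intro x y h
    have h' := b.equivFun.symm.injective h
    funext i
    exact Subtype.ext (congrFun h' i)
  have hr : LinearMap.range φ = I • (⊤ : Submodule R F) := by
    apply le_antisymm
    · rintro _ ⟨v, rfl⟩
      change b.equivFun.symm _ ∈ _
      rw [Module.Basis.equivFun_symm_apply]
      exact Submodule.sum_mem _ fun i _ => Submodule.smul_mem_smul (v i).2 trivial
    · refine Submodule.smul_le.2 fun a ha x _ => ⟨fun i => ⟨a * b.equivFun x i, I.mul_mem_right _ ha⟩, ?_⟩
      apply b.equivFun.injective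
      change b.equivFun (b.equivFun.symm _) = _
      rw [LinearEquiv.apply_symm_apply, map_smul]
      rfl
  rw [← hr, ← (LinearEquiv.ofInjective φ hinj).length_eq]
  simp

theorem len_ideal_eq {R M : Type} [CommRing R] [AddCommGroup M] [Module R M]
    (N : Submodule R M) (I : Ideal R) :
    Module.length R (I • (⊤ : Submodule R N) : Submodule R N)
      = Module.length R (I • N : Submodule R M) := by
  have h : Submodule.map N.subtype (I • (⊤ : Submodule R N)) = I • N := by
    rw [Submodule.map_smul'', Submodule.map_top, Submodule.range_subtype]
  rw [← h]
  exact (Submodule.equivMapOfInjective N.subtype N.subtype_injective _).length_eq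

theorem len_quot {R M : Type} [CommRing R] [AddCommGroup M] [Module R M] (N : Submodule R M) :
    Module.length R M = Module.length R N + Module.length R (M ⧸ N) :=
  Module.length_eq_add_of_exact N.subtype N.mkQ N.subtype_injective N.mkQ_surjective
    (LinearMap.exact_subtype_mkQ N)

theorem len_residue (R : Type) [CommRing R] [IsLocalRing R] :
    Module.length R (ResidueField R) = 1 := by
  have : IsSimpleModule R (ResidueField R) := by
    have := isSimpleModule_iff_isCoatom.2 (IsLocalRing.maximalIdeal.isMaximal R).out
    exact this
  exact Module.length_eq_one_iff.2 this

theorem len_R (R : Type) [CommRing R] [IsLocalRing R] :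
    Module.length R R = Module.length R (maximalIdeal R) + 1 := by
  rw [len_quot (maximalIdeal R), ← len_residue R]
  rfl

theorem len_R' (R : Type) [CommRing R] [IsLocalRing R] :
    Module.length R R = Module.length R (maximalIdeal R ^ 2 : Ideal R)
      + Module.length R (CotangentSpace R) + 1 := by
  rw [len_R, len_quot (maximalIdeal R • ⊤ : Submodule R (maximalIdeal R)), len_ideal_eq, pow_two]
  rfl

theorem len_quot_min {R : Type} [CommRing R] [IsLocalRing R] [IsArtinianRing R]
    (G : Type) [AddCommGroup G]
    [Module R G] [Module.Free R G] [Module.Finite R G] :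
    Module.length R (G ⧸ (maximalIdeal R • ⊤ : Submodule R G)) = Module.finrank R G := by
  have h1 := len_quot (maximalIdeal R • ⊤ : Submodule R G)
  have h2 := len_smul_top (maximalIdeal R) G
  have h3 := len_smul_top (⊤ : Ideal R) G
  have h4 := len_R R
  rw [Submodule.top_smul, Module.length_top, Module.length_top] at h3
  have h5 : Module.length R (maximalIdeal R) ≠ ⊤ := Module.length_ne_top
  rw [h3, h2, h4, mul_add, mul_one] at h1
  exact (ENat.add_right_injective_of_ne_top (WithTop.mul_ne_top (ENat.natCast_ne_top _) h5) h1).symm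

theorem len_cover {R : Type} [CommRing R] [IsLocalRing R] [IsArtinianRing R]
    {G N : Type} [AddCommGroup G] [Module R G] [Module.Free R G] [Module.Finite R G]
    [AddCommGroup N] [Module R N] (g : G →ₗ[R] N) (hg : Function.Surjective g)
    (hk : LinearMap.ker g ≤ maximalIdeal R • ⊤) :
    Module.length R N = Module.length R (maximalIdeal R • ⊤ : Submodule R N)
      + Module.finrank R G := by
  rw [len_quot (maximalIdeal R • ⊤ : Submodule R N), ← len_quot_min G]
  congr 1
  let q := (maximalIdeal R • ⊤ : Submodule R N).mkQ ∘ₗ g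
  have hq : LinearMap.ker q = maximalIdeal R • ⊤ := by
    have : maximalIdeal R • (⊤ : Submodule R N) = Submodule.map g (maximalIdeal R • ⊤) := by
      rw [Submodule.map_smul'', Submodule.map_top, LinearMap.range_eq_top.2 hg]
    rw [LinearMap.ker_comp, Submodule.ker_mkQ, this, Submodule.comap_map_eq, sup_eq_left.2 hk]
  have hs : Function.Surjective q := (Submodule.mkQ_surjective _).comp hg
  rw [← hq]
  exact (q.quotKerEquivOfSurjective hs).length_eq.symm

theorem retr_lift {R : Type} [CommRing R] [IsLocalRing R] [IsNoetherianRing R]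
    {K F M K' G N : Type}
    [AddCommGroup K] [Module R K] [AddCommGroup F] [Module R F] [AddCommGroup M] [Module R M]
    [AddCommGroup K'] [Module R K'] [AddCommGroup G] [Module R G] [AddCommGroup N] [Module R N]
    [Module.Free R F] [Module.Finite R F] [Module.Free R G] [Module.Finite R G]
    (j : K →ₗ[R] F) (f : F →ₗ[R] M) (j' : K' →ₗ[R] G) (g : G →ₗ[R] N)
    (hj : Function.Injective j) (hf : Function.Surjective f) (hjf : LinearMap.range j = LinearMap.ker f)
    (hmin : LinearMap.ker f ≤ maximalIdeal R • ⊤)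
    (hj' : Function.Injective j') (hg : Function.Surjective g)
    (hjg : LinearMap.range j' = LinearMap.ker g) (h : IsRetr R M N) :
    IsRetr R K K' ∧ Module.finrank R F ≤ Module.finrank R G := by
  obtain ⟨i, p, hip⟩ := h
  obtain ⟨φ, hφ⟩ := Module.projective_lifting_property g (i ∘ₗ f) hg
  obtain ⟨ψ, hψ⟩ := Module.projective_lifting_property f (p ∘ₗ g) hf
  have hc : f ∘ₗ (ψ ∘ₗ φ) = f := by
    rw [← LinearMap.comp_assoc, hψ, LinearMap.comp_assoc, hφ, ← LinearMap.comp_assoc, hip,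
      LinearMap.id_comp]
  have hs : Function.Surjective (ψ ∘ₗ φ) := by
    rw [← LinearMap.range_eq_top, eq_top_iff]
    refine Submodule.le_of_le_smul_of_le_jacobson_bot (I := maximalIdeal R) Module.Finite.fg_top
      (IsLocalRing.maximalIdeal_le_jacobson _) ?_
    intro x _
    have : x - (ψ ∘ₗ φ) x ∈ maximalIdeal R • (⊤ : Submodule R F) := by
      apply hmin
      rw [LinearMap.mem_ker, map_sub, ← LinearMap.comp_apply, hc, sub_self]
    have h2 := Submodule.add_mem_sup (LinearMap.mem_range_self (ψ ∘ₗ φ) x) this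
    simpa using h2
  have hi : Function.Injective (ψ ∘ₗ φ) := IsNoetherian.injective_of_surjective_endomorphism _ hs
  let θ := LinearEquiv.ofBijective (ψ ∘ₗ φ) ⟨hi, hs⟩
  have hθ : ∀ x, f (θ.symm x) = f x := by
    intro x
    have := LinearMap.congr_fun hc (θ.symm x)
    rw [← this]
    exact congrArg f (θ.apply_symm_apply x)
  have hφi : Function.Injective φ := by
    intro x y hxy
    apply hi
    simp [hxy]
  constructor
  · have e1 : ∀ x : K, φ (j x) ∈ LinearMap.range j' := by
      intro x
      have hx : f (j x) = 0 := by
        have : j x ∈ LinearMap.ker f := hjf ▸ LinearMap.mem_range_self j x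
        exact this
      rw [hjg, LinearMap.mem_ker, ← LinearMap.comp_apply, hφ]
      simp [hx]
    have e2 : ∀ x : K', θ.symm (ψ (j' x)) ∈ LinearMap.range j := by
      intro x
      have hx : g (j' x) = 0 := by
        have : j' x ∈ LinearMap.ker g := hjg ▸ LinearMap.mem_range_self j' x
        exact this
      rw [hjf, LinearMap.mem_ker, hθ, ← LinearMap.comp_apply, hψ]
      simp [hx]
    let E := LinearEquiv.ofInjective j hj
    let E' := LinearEquiv.ofInjective j' hj'
    refine ⟨E'.symm.toLinearMap ∘ₗ (φ ∘ₗ j).codRestrict _ e1,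
      E.symm.toLinearMap ∘ₗ (θ.symm.toLinearMap ∘ₗ ψ ∘ₗ j').codRestrict _ e2, ?_⟩
    ext x
    change E.symm _ = x
    rw [LinearEquiv.symm_apply_eq]
    apply Subtype.ext
    change θ.symm (ψ (j' (E'.symm ⟨φ (j x), e1 x⟩))) = j x
    have : j' (E'.symm ⟨φ (j x), e1 x⟩) = φ (j x) := by
      have := congrArg Subtype.val (E'.apply_symm_apply ⟨φ (j x), e1 x⟩)
      exact this
    rw [this, LinearEquiv.symm_apply_eq]
    rfl
  · exact LinearMap.finrank_le_finrank_of_injective hφi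

theorem mem_smul_top_fin {R : Type} [CommRing R] (I : Ideal R) {n : ℕ} (x : Fin n → R)
    (h : ∀ i, x i ∈ I) : x ∈ (I • ⊤ : Submodule R (Fin n → R)) := by
  rw [← (Pi.basisFun R (Fin n)).sum_equivFun x]
  refine Submodule.sum_mem _ fun i _ => Submodule.smul_mem_smul ?_ trivial
  simpa using h i

open TensorProduct in
theorem exists_cover {R : Type} [CommRing R] [IsLocalRing R] (M : Type) [AddCommGroup M]
    [Module R M] [Module.Finite R M] :
    ∃ (n : ℕ) (f : (Fin n → R) →ₗ[R] M), Function.Surjective f ∧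
      LinearMap.ker f ≤ maximalIdeal R • ⊤ := by
  let b := Module.finBasis (ResidueField R) (ResidueField R ⊗[R] M)
  have hs : Function.Surjective (TensorProduct.mk R (ResidueField R) M 1) :=
    TensorProduct.mk_surjective R M (ResidueField R) Ideal.Quotient.mk_surjective
  choose v hv using fun i => hs (b i)
  have hsp := IsLocalRing.span_eq_top_of_tmul_eq_basis v b hv
  refine ⟨_, Fintype.linearCombination R v, ?_, ?_⟩
  · rw [← LinearMap.range_eq_top, Fintype.range_linearCombination, hsp]
  · intro x hx
    apply mem_smul_top_fin
    have h0 : ∑ i, residue R (x i) • b i = 0 := by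
      have h1 := congrArg (TensorProduct.mk R (ResidueField R) M 1) (LinearMap.mem_ker.1 hx)
      rw [Fintype.linearCombination_apply, map_sum, map_zero] at h1
      rw [← h1]
      refine Finset.sum_congr rfl fun i _ => ?_
      rw [map_smul, hv]
      exact algebraMap_smul (ResidueField R) (x i) (b i)
    intro i
    have := Fintype.linearIndependent_iff.1 b.linearIndependent _ h0 i
    exact (residue_eq_zero_iff _).1 this

theorem mem_socle {R : Type} [CommRing R] [IsLocalRing R] {s : R} :
    s ∈ socle R ↔ ∀ a ∈ maximalIdeal R, s * a = 0 := by
  unfold socle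
  rw [Submodule.mem_colon]
  simp

theorem socle_smul {R : Type} [CommRing R] [IsLocalRing R] {F : Type} [AddCommGroup F]
    [Module R F] {s : R} (hs : s ∈ socle R) {x : F}
    (hx : x ∈ (maximalIdeal R • ⊤ : Submodule R F)) : s • x = 0 := by
  refine Submodule.smul_induction_on hx ?_ ?_
  · intro a ha y _
    rw [smul_smul, mem_socle.1 hs a ha, zero_smul]
  · intro y z hy hz
    rw [smul_add, hy, hz, add_zero]

theorem sq_le_socle {R : Type} [CommRing R] [IsLocalRing R] (h3 : maximalIdeal R ^ 3 = ⊥) :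
    maximalIdeal R ^ 2 ≤ socle R := by
  intro s hs
  rw [mem_socle]
  intro a ha
  have : s * a ∈ maximalIdeal R ^ 3 := by
    rw [pow_succ]
    exact Ideal.mul_mem_mul hs ha
  rw [h3] at this
  exact this

theorem retr_k {R : Type} [CommRing R] [IsLocalRing R] {N : Type} [AddCommGroup N]
    [Module R N] (x : N) (hx : ∀ a ∈ maximalIdeal R, a • x = 0)
    (hx' : x ∉ (maximalIdeal R • ⊤ : Submodule R N)) : IsRetr R (ResidueField R) N := by
  let _ : Field (R ⧸ maximalIdeal R) := Ideal.Quotient.field _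
  let V := N ⧸ (maximalIdeal R • ⊤ : Submodule R N)
  let y : V := Submodule.Quotient.mk x
  have hy : y ≠ 0 := by
    intro h
    exact hx' ((Submodule.Quotient.mk_eq_zero _).1 h)
  obtain ⟨f, hf⟩ := Module.Projective.exists_dual_ne_zero (R ⧸ maximalIdeal R) hy
  let g : N →ₗ[R] (R ⧸ maximalIdeal R) :=
    (((f y)⁻¹ • f).restrictScalars R) ∘ₗ (maximalIdeal R • ⊤ : Submodule R N).mkQ
  have hg : g x = 1 := inv_mul_cancel₀ hf
  let i : (R ⧸ maximalIdeal R) →ₗ[R] N :=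
    Submodule.liftQ (maximalIdeal R) (LinearMap.toSpanSingleton R N x) (by
      intro a ha
      exact hx a ha)
  refine ⟨i, g, ?_⟩
  change g ∘ₗ i = (LinearMap.id : (R ⧸ maximalIdeal R) →ₗ[R] _)
  apply Submodule.linearMap_qext
  ext
  change g ((1 : R) • x) = 1
  rw [one_smul, hg]

theorem socle_le_of_not_retr {R : Type} [CommRing R] [IsLocalRing R] {F : Type} [AddCommGroup F]
    [Module R F] (C : Submodule R F) (hC : socle R • ⊤ ≤ C)
    (hn : ¬ IsRetr R (ResidueField R) C) : socle R • ⊤ ≤ maximalIdeal R • C := by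
  intro x hx
  by_contra hcon
  apply hn
  refine retr_k (⟨x, hC hx⟩ : C) ?_ ?_
  · intro a ha
    apply Subtype.ext
    change a • x = 0
    refine Submodule.smul_induction_on hx ?_ ?_
    · intro s hs y _
      rw [smul_smul, mul_comm, mem_socle.1 hs a ha, zero_smul]
    · intro y z hy hz
      rw [smul_add, hy, hz, add_zero]
  · intro h
    apply hcon
    have : Submodule.map C.subtype (maximalIdeal R • (⊤ : Submodule R C)) = maximalIdeal R • C := by
      rw [Submodule.map_smul'', Submodule.map_top, Submodule.range_subtype]
    rw [← this]
    exact ⟨_, h, rfl⟩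

theorem smul_eq_of_not_retr {R : Type} [CommRing R] [IsLocalRing R]
    (h3 : maximalIdeal R ^ 3 = ⊥) {F : Type} [AddCommGroup F]
    [Module R F] (C : Submodule R F) (hC : socle R • ⊤ ≤ C) (hCm : C ≤ maximalIdeal R • ⊤)
    (hn : ¬ IsRetr R (ResidueField R) C) :
    maximalIdeal R • C = socle R • ⊤ ∧ maximalIdeal R • C ≤ maximalIdeal R ^ 2 • ⊤ := by
  have h1 : maximalIdeal R • C ≤ maximalIdeal R ^ 2 • ⊤ := by
    rw [pow_two, ← smul_eq_mul, Submodule.smul_assoc]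
    exact Submodule.smul_mono le_rfl hCm
  exact ⟨le_antisymm (h1.trans (Submodule.smul_mono_left (sq_le_socle h3)))
    (socle_le_of_not_retr C hC hn), h1⟩

/-- If `soc R • F ≤ m² F` with `F ≠ 0` free, then `soc R = m²`. -/
theorem socle_eq_sq {R : Type} [CommRing R] [IsLocalRing R] [IsArtinianRing R]
    (h3 : maximalIdeal R ^ 3 = ⊥) {F : Type} [AddCommGroup F]
    [Module R F] [Module.Free R F] [Module.Finite R F] [Nontrivial F]
    (h : (socle R • ⊤ : Submodule R F) ≤ maximalIdeal R ^ 2 • ⊤) :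
    socle R = maximalIdeal R ^ 2 := by
  have hpos : 0 < Module.finrank R F := Module.finrank_pos_iff_of_free R F |>.2 inferInstance
  refine le_antisymm ?_ (sq_le_socle h3)
  let b := Module.finBasis R F
  intro s hs
  have h1 := h (Submodule.smul_mem_smul hs (trivial : b ⟨0, hpos⟩ ∈ ⊤))
  have h2 : ∀ x ∈ (maximalIdeal R ^ 2 • ⊤ : Submodule R F),
      b.repr x ⟨0, hpos⟩ ∈ maximalIdeal R ^ 2 := by
    intro x hx
    refine Submodule.smul_induction_on hx ?_ ?_
    · intro a ha y _
      rw [map_smul]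
      exact Ideal.mul_mem_right _ _ ha
    · intro y z hy hz
      rw [map_add]
      exact Ideal.add_mem _ hy hz
  simpa using h2 _ h1

/-- Length of the image of a minimal map. -/
theorem len_range {R : Type} [CommRing R] [IsLocalRing R] [IsArtinianRing R]
    {F G : Type} [AddCommGroup F] [Module R F] [Module.Free R F] [Module.Finite R F]
    [AddCommGroup G] [Module R G] [Module.Free R G] [Module.Finite R G]
    (C : Submodule R F) (g : G →ₗ[R] C) (hg : Function.Surjective g)
    (hk : LinearMap.ker g ≤ maximalIdeal R • ⊤)
    (h : maximalIdeal R • C = socle R • ⊤) :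
    Module.length R C = Module.finrank R F * Module.length R (socle R) + Module.finrank R G := by
  rw [len_cover g hg hk, len_ideal_eq, h, len_smul_top]

theorem len_ker {R : Type} [CommRing R] [IsLocalRing R]
    {G C : Type} [AddCommGroup G] [Module R G] [Module.Free R G] [Module.Finite R G]
    [AddCommGroup C] [Module R C] (g : G →ₗ[R] C) (hg : Function.Surjective g) :
    Module.length R (LinearMap.ker g) + Module.length R C
      = Module.finrank R G * Module.length R R := by
  rw [← Module.length_eq_add_of_exact (LinearMap.ker g).subtype g (Submodule.subtype_injective _) hg
    (LinearMap.exact_subtype_ker_map g)]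
  have h3 := len_smul_top (⊤ : Ideal R) G
  rwa [Submodule.top_smul, Module.length_top, Module.length_top] at h3

/-- The recurrence `e β_{n} = β_{n+1} + r β_{n-1}`. -/
theorem recurrence {R : Type} [CommRing R] [IsLocalRing R] [IsArtinianRing R]
    {e r : ℕ} (he : Module.length R (CotangentSpace R) = e) (hr : Module.length R (socle R) = r)
    (hsoc : socle R = maximalIdeal R ^ 2)
    {F G H : Type} [AddCommGroup F] [Module R F] [Module.Free R F] [Module.Finite R F]
    [AddCommGroup G] [Module R G] [Module.Free R G] [Module.Finite R G]
    [AddCommGroup H] [Module R H] [Module.Free R H] [Module.Finite R H]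
    (C : Submodule R F) (g : G →ₗ[R] C) (hg : Function.Surjective g)
    (K : Submodule R G) (hK : LinearMap.ker g = K)
    (hk : K ≤ maximalIdeal R • ⊤)
    (k : H →ₗ[R] K) (hks : Function.Surjective k) (hkk : LinearMap.ker k ≤ maximalIdeal R • ⊤)
    (h : maximalIdeal R • C = socle R • ⊤) (h' : maximalIdeal R • K = socle R • ⊤) :
    e * Module.finrank R G = Module.finrank R H + r * Module.finrank R F := by
  have h1 := len_range C g hg (hK ▸ hk) h
  have h2 := len_range K k hks hkk h'
  have h3 := len_ker g hg
  rw [hK, h1, h2, len_R', ← hsoc, hr, he] at h3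
  norm_cast at h3
  nlinarith

/-- `p` is the sequence of syzygies (embedded in free modules) of a minimal free resolution
of `M`. -/
structure IsRes (R : Type) [CommRing R] [IsLocalRing R] (M : Type) [AddCommGroup M] [Module R M]
    (p : ℕ → Σ n : ℕ, Submodule R (Fin n → R)) : Prop where
  zero : ∃ f : (Fin (p 0).1 → R) →ₗ[R] M, Function.Surjective f ∧ LinearMap.ker f = (p 0).2
  min : ∀ n, (p n).2 ≤ maximalIdeal R • ⊤
  succ : ∀ n, ∃ f : (Fin (p (n + 1)).1 → R) →ₗ[R] (p n).2,
    Function.Surjective f ∧ LinearMap.ker f = (p (n + 1)).2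

theorem exists_res (R : Type) [CommRing R] [IsNoetherianRing R] [IsLocalRing R]
    (M : Type) [AddCommGroup M] [Module R M] [Module.Finite R M] : ∃ p, IsRes R M p := by
  obtain ⟨n0, f0, hf0, hk0⟩ := exists_cover (R := R) M
  have step : ∀ q : Σ n : ℕ, Submodule R (Fin n → R), ∃ q' : Σ n : ℕ, Submodule R (Fin n → R),
      q'.2 ≤ maximalIdeal R • ⊤ ∧ ∃ f : (Fin q'.1 → R) →ₗ[R] q.2,
        Function.Surjective f ∧ LinearMap.ker f = q'.2 := by
    intro q
    obtain ⟨n, f, hf, hk⟩ := exists_cover (R := R) q.2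
    exact ⟨⟨n, LinearMap.ker f⟩, hk, f, hf, rfl⟩
  choose S hS1 hS2 using step
  refine ⟨fun n => Nat.rec ⟨n0, LinearMap.ker f0⟩ (fun _ q => S q) n, ⟨f0, hf0, rfl⟩, ?_, ?_⟩
  · intro n
    cases n with
    | zero => exact hk0
    | succ n => exact hS1 _
  · intro n
    exact hS2 _

theorem IsRes.shift {R : Type} [CommRing R] [IsLocalRing R] {M : Type} [AddCommGroup M]
    [Module R M] {p : ℕ → Σ n : ℕ, Submodule R (Fin n → R)} (h : IsRes R M p) (n : ℕ) :
    IsRes R (p n).2 (fun i => p (n + 1 + i)) :=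
  ⟨h.succ n, fun _ => h.min _, fun i => h.succ (n + 1 + i)⟩

theorem ker_prodMap_le {R : Type} [CommRing R] (I : Ideal R) {F G M N : Type}
    [AddCommGroup F] [Module R F] [AddCommGroup G] [Module R G]
    [AddCommGroup M] [Module R M] [AddCommGroup N] [Module R N]
    (f : F →ₗ[R] M) (g : G →ₗ[R] N) (hf : LinearMap.ker f ≤ I • ⊤)
    (hg : LinearMap.ker g ≤ I • ⊤) :
    LinearMap.ker (f.prodMap g) ≤ I • ⊤ := by
  rintro ⟨x, y⟩ hxy
  rw [LinearMap.mem_ker, LinearMap.prodMap_apply, Prod.mk_eq_zero] at hxy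
  have h1 : (x, (0 : G)) ∈ (I • ⊤ : Submodule R (F × G)) := by
    have : Submodule.map (LinearMap.inl R F G) (I • ⊤) ≤ I • ⊤ := by
      rw [Submodule.map_smul'']
      exact Submodule.smul_mono le_rfl le_top
    exact this ⟨x, hf hxy.1, rfl⟩
  have h2 : ((0 : F), y) ∈ (I • ⊤ : Submodule R (F × G)) := by
    have : Submodule.map (LinearMap.inr R F G) (I • ⊤) ≤ I • ⊤ := by
      rw [Submodule.map_smul'']
      exact Submodule.smul_mono le_rfl le_top
    exact this ⟨y, hg hxy.2, rfl⟩
  simpa using Submodule.add_mem _ h1 h2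

theorem retr_prod_step {R : Type} [CommRing R] [IsLocalRing R] [IsNoetherianRing R]
    {M T N : Type} [AddCommGroup M] [Module R M] [AddCommGroup T] [Module R T]
    [AddCommGroup N] [Module R N] {a b c : ℕ}
    (f : (Fin a → R) →ₗ[R] M) (g : (Fin b → R) →ₗ[R] T) (k : (Fin c → R) →ₗ[R] N)
    (hf : Function.Surjective f) (hg : Function.Surjective g) (hk : Function.Surjective k)
    (A : Submodule R (Fin a → R)) (B : Submodule R (Fin b → R)) (C : Submodule R (Fin c → R))
    (hA : LinearMap.ker f = A) (hB : LinearMap.ker g = B) (hC : LinearMap.ker k = C)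
    (hAm : A ≤ maximalIdeal R • ⊤) (hBm : B ≤ maximalIdeal R • ⊤)
    (h : IsRetr R (M × T) N) : IsRetr R (A × B) C ∧ a + b ≤ c := by
  have := retr_lift (A.subtype.prodMap B.subtype) (f.prodMap g) C.subtype k
    (Prod.map_injective.2 ⟨A.subtype_injective, B.subtype_injective⟩) (hf.prodMap hg) (by
      subst hA hB
      ext ⟨x, y⟩
      simp) (ker_prodMap_le _ f g (hA ▸ hAm) (hB ▸ hBm)) C.subtype_injective hk (by simp [hC]) h
  simpa using this

theorem res_retr_prod {R : Type} [CommRing R] [IsLocalRing R] [IsNoetherianRing R]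
    {M T N : Type} [AddCommGroup M] [Module R M] [AddCommGroup T] [Module R T]
    [AddCommGroup N] [Module R N] {p t q : ℕ → Σ n : ℕ, Submodule R (Fin n → R)}
    (hp : IsRes R M p) (ht : IsRes R T t) (hq : IsRes R N q) (h : IsRetr R (M × T) N) :
    ∀ n, IsRetr R ((p n).2 × (t n).2) (q n).2 ∧ (p n).1 + (t n).1 ≤ (q n).1 := by
  intro n
  induction n with
  | zero =>
    obtain ⟨f, hf, hf'⟩ := hp.zero
    obtain ⟨g, hg, hg'⟩ := ht.zero
    obtain ⟨k, hk, hk'⟩ := hq.zero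
    exact retr_prod_step f g k hf hg hk _ _ _ hf' hg' hk' (hp.min 0) (ht.min 0) h
  | succ n ih =>
    obtain ⟨f, hf, hf'⟩ := hp.succ n
    obtain ⟨g, hg, hg'⟩ := ht.succ n
    obtain ⟨k, hk, hk'⟩ := hq.succ n
    exact retr_prod_step f g k hf hg hk _ _ _ hf' hg' hk' (hp.min _) (ht.min _) ih.1

theorem socle_le_ker {R : Type} [CommRing R] [IsLocalRing R] {F X : Type} [AddCommGroup F]
    [Module R F] [AddCommGroup X] [Module R X] (f : F →ₗ[R] X)
    (h : ∀ s ∈ socle R, ∀ x : X, s • x = 0) : socle R • ⊤ ≤ LinearMap.ker f := by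
  refine Submodule.smul_le.2 fun s hs x _ => ?_
  rw [LinearMap.mem_ker, map_smul, h s hs]

theorem kills_sub {R : Type} [CommRing R] [IsLocalRing R] {F : Type} [AddCommGroup F]
    [Module R F] (C : Submodule R F) (h : C ≤ maximalIdeal R • ⊤) :
    ∀ s ∈ socle R, ∀ x : C, s • x = 0 := fun _ hs x =>
  Subtype.ext (socle_smul hs (h x.2))

theorem pos_step {R : Type} [CommRing R] [IsLocalRing R] (hs : socle R ≠ ⊥) {X : Type}
    [AddCommGroup X] [Module R X] [Nontrivial X] (hX : ∀ s ∈ socle R, ∀ x : X, s • x = 0)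
    {n : ℕ} (f : (Fin n → R) →ₗ[R] X) (hf : Function.Surjective f) :
    0 < n ∧ Nontrivial (LinearMap.ker f) := by
  have hn : 0 < n := by
    rcases Nat.eq_zero_or_pos n with h | h
    · subst h
      have := hf.subsingleton
      exact (not_subsingleton X this).elim
    · exact h
  refine ⟨hn, ?_⟩
  obtain ⟨s, hs, hs0⟩ := Submodule.exists_mem_ne_zero_of_ne_bot hs
  rw [Submodule.nontrivial_iff_ne_bot, Submodule.ne_bot_iff]
  refine ⟨s • (fun _ => 1), socle_le_ker f hX (Submodule.smul_mem_smul hs trivial), ?_⟩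
  intro h
  have := congrFun h ⟨0, hn⟩
  simp at this
  exact hs0 this

theorem res_pos {R : Type} [CommRing R] [IsLocalRing R] (hs : socle R ≠ ⊥) {X : Type}
    [AddCommGroup X] [Module R X] [Nontrivial X] (hX : ∀ s ∈ socle R, ∀ x : X, s • x = 0)
    {p : ℕ → Σ n : ℕ, Submodule R (Fin n → R)} (hp : IsRes R X p) (n : ℕ) :
    0 < (p n).1 ∧ Nontrivial (p n).2 := by
  induction n with
  | zero =>
    obtain ⟨f, hf, hf'⟩ := hp.zero
    rw [← hf']
    exact pos_step hs hX f hf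
  | succ n ih =>
    obtain ⟨f, hf, hf'⟩ := hp.succ n
    rw [← hf']
    have := ih.2
    exact pos_step hs (kills_sub _ (hp.min n)) f hf

theorem res_socle_le {R : Type} [CommRing R] [IsLocalRing R] {X : Type}
    [AddCommGroup X] [Module R X] (hX : ∀ s ∈ socle R, ∀ x : X, s • x = 0)
    {p : ℕ → Σ n : ℕ, Submodule R (Fin n → R)} (hp : IsRes R X p) (n : ℕ) :
    socle R • ⊤ ≤ (p n).2 := by
  cases n with
  | zero =>
    obtain ⟨f, hf, hf'⟩ := hp.zero
    rw [← hf']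
    exact socle_le_ker f hX
  | succ n =>
    obtain ⟨f, hf, hf'⟩ := hp.succ n
    rw [← hf']
    exact socle_le_ker f (kills_sub _ (hp.min n))

theorem grow_aux (β : ℕ → ℕ) (e r : ℕ) (hr : 1 ≤ r)
    (h : ∀ n, e * β (n + 1) = β (n + 2) + r * β n) (h0 : β 0 = 1) (h1 : β 1 = e) (n : ℕ) :
    n ≤ β n := by
  have hD : ∀ n, β (n + 2) * β n < β (n + 1) * β (n + 1) := by
    intro n
    induction n with
    | zero =>
      have := h 0
      simp only [zero_add] at this ⊢
      rw [h0, h1] at *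
      nlinarith
    | succ n ih =>
      have a := h n
      have b := h (n + 1)
      simp only [add_assoc] at *
      norm_num at *
      zify at *
      have key : (β (n + 2) : ℤ) * β (n + 2) - β (n + 3) * β (n + 1)
          = r * (β (n + 1) * β (n + 1) - β (n + 2) * β n) := by
        linear_combination (β (n + 1) : ℤ) * b - (β (n + 2) : ℤ) * a
      have : 0 < (r : ℤ) * (β (n + 1) * β (n + 1) - β (n + 2) * β n) :=
        mul_pos (by omega) (by linarith)
      linarith
  have hinc : ∀ n, β n < β (n + 1) := by
    intro n
    by_contra hcon
    push Not at hcon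
    have hdec : ∀ j, β (n + j + 1) + j ≤ β n ∧ β (n + j + 1) ≤ β (n + j) := by
      intro j
      induction j with
      | zero => exact ⟨by simpa using hcon, by simpa using hcon⟩
      | succ j ih =>
        have hd := hD (n + j)
        have : β (n + j + 2) < β (n + j + 1) := by
          by_contra hc
          push Not at hc
          nlinarith [Nat.mul_le_mul hc ih.2]
        have e1 : n + (j + 1) + 1 = n + j + 2 := by ring
        have e2 : n + (j + 1) = n + j + 1 := by ring
        rw [e1, e2]
        exact ⟨by omega, this.le⟩
    have := (hdec (β n + 1)).1
    omega
  induction n with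
  | zero => omega
  | succ n ih => have := hinc n; omega

theorem socle_le_max {R : Type} [CommRing R] [IsLocalRing R] (h2 : maximalIdeal R ^ 2 ≠ ⊥) :
    socle R ≤ maximalIdeal R := by
  intro s hs
  by_contra hcon
  apply h2
  have hu : IsUnit s := by simpa using hcon
  have : maximalIdeal R = ⊥ := by
    rw [eq_bot_iff]
    intro a ha
    have := mem_socle.1 hs a ha
    exact (hu.mul_right_eq_zero).1 this
  rw [this]
  simp [pow_two]

theorem kills_residue {R : Type} [CommRing R] [IsLocalRing R] (h2 : maximalIdeal R ^ 2 ≠ ⊥) :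
    ∀ s ∈ socle R, ∀ x : ResidueField R, s • x = 0 := by
  intro s hs x
  rw [← algebraMap_smul (ResidueField R) s x]
  have : algebraMap R (ResidueField R) s = 0 := (residue_eq_zero_iff _).2 (socle_le_max h2 hs)
  rw [this, zero_smul]

theorem betti_grow {R : Type} [CommRing R] [IsNoetherianRing R] [IsArtinianRing R] [IsLocalRing R]
    (h3 : maximalIdeal R ^ 3 = ⊥) (h2 : maximalIdeal R ^ 2 ≠ ⊥)
    {e r : ℕ} (he : Module.length R (CotangentSpace R) = e) (hr : Module.length R (socle R) = r)
    (hr2 : 2 ≤ r)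
    {p : ℕ → Σ n : ℕ, Submodule R (Fin n → R)} (hp : IsRes R (ResidueField R) p) :
    ∀ K : ℕ, ∃ N, ∀ i, N ≤ i → K ≤ (p i).1 := by
  have hs : socle R ≠ ⊥ := fun h => h2 (le_bot_iff.1 (h ▸ sq_le_socle h3))
  have hpos := res_pos hs (kills_residue h2) hp
  have hsle := res_socle_le (kills_residue h2) hp
  by_cases hcase : ∃ n, IsRetr R (ResidueField R) (p n).2
  · obtain ⟨n, i, π, hπ⟩ := hcase
    have hπ' : ∀ x, π (i x) = x := fun x => LinearMap.congr_fun hπ x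
    have hT : Nontrivial (LinearMap.ker π) := by
      rw [Submodule.nontrivial_iff_ne_bot]
      intro hbot
      have l1 := Module.length_le_of_injective π (LinearMap.ker_eq_bot.1 hbot)
      have l2 := Module.length_le_of_injective (Submodule.inclusion (hsle n))
        (Submodule.inclusion_injective _)
      have l3 := l2.trans l1
      rw [len_smul_top, len_residue, hr] at l3
      have l4 := (hpos n).1
      simp only [Module.finrank_fin_fun] at l3
      norm_cast at l3
      nlinarith
    have hret : IsRetr R (ResidueField R × LinearMap.ker π) (p n).2 := by
      have hcod : ∀ x, ((LinearMap.id : (p n).2 →ₗ[R] (p n).2) - i ∘ₗ π) x ∈ LinearMap.ker π := by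
        intro x
        simp [hπ']
      refine ⟨i.coprod (LinearMap.ker π).subtype,
        π.prod ((LinearMap.id - i ∘ₗ π).codRestrict _ hcod), ?_⟩
      · apply LinearMap.ext
        rintro ⟨x, y, hy⟩
        rw [LinearMap.mem_ker] at hy
        refine Prod.ext ?_ (Subtype.ext ?_)
        · simp [hπ', hy]
        · simp [hπ', hy]
    have hkill : ∀ s ∈ socle R, ∀ x : LinearMap.ker π, s • x = 0 := fun s hs x =>
      Subtype.ext (kills_sub _ (hp.min n) s hs x.1)
    obtain ⟨t, ht⟩ := exists_res R (LinearMap.ker π)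
    have hfin := res_retr_prod hp ht (hp.shift n) hret
    have htp := res_pos hs hkill ht
    intro K
    induction K with
    | zero => exact ⟨0, fun _ _ => Nat.zero_le _⟩
    | succ K ih =>
      obtain ⟨N, hN⟩ := ih
      refine ⟨n + 1 + N, fun j hj => ?_⟩
      obtain ⟨j', rfl⟩ : ∃ j', j = n + 1 + j' := ⟨j - (n + 1), by omega⟩
      have a := hN j' (by omega)
      have b := (hfin j').2
      have c := (htp j').1
      omega
  · push Not at hcase
    have hall := fun n => smul_eq_of_not_retr h3 _ (hsle n) (hp.min n) (hcase n)
    obtain ⟨f0, hf0, hk0⟩ := hp.zero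
    have hp0 : (p 0).1 = 1 := by
      have a := len_cover f0 hf0 (hk0 ▸ hp.min 0)
      rw [len_residue, Module.finrank_fin_fun] at a
      have b : ((p 0).1 : ℕ∞) ≤ 1 := a ▸ le_add_self
      have c := (hpos 0).1
      norm_cast at b
      omega
    have hsoc : socle R = maximalIdeal R ^ 2 := by
      have : Nontrivial (Fin (p 0).1 → R) := by
        rw [hp0]
        infer_instance
      refine socle_eq_sq h3 (F := Fin (p 0).1 → R) ?_
      rw [← (hall 0).1]
      exact (hall 0).2
    have hrec : ∀ n, e * (p (n + 1)).1 = (p (n + 2)).1 + r * (p n).1 := by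
      intro n
      obtain ⟨f, hf, hf'⟩ := hp.succ n
      obtain ⟨g, hg, hg'⟩ := hp.succ (n + 1)
      have := recurrence he hr hsoc (p n).2 f hf (p (n + 1)).2 hf' (hp.min _) g hg
        (hg' ▸ hp.min _) (hall n).1 (hall (n + 1)).1
      simpa using this
    have hp1 : (p 1).1 = e := by
      obtain ⟨f, hf, hf'⟩ := hp.succ 0
      have a := len_range (p 0).2 f hf (hf' ▸ hp.min _) (hall 0).1
      have b := len_ker f0 hf0
      rw [hk0, a, len_residue, len_R', ← hsoc, he, hr] at b
      simp only [Module.finrank_fin_fun, hp0] at b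
      norm_cast at b
      simp only [zero_add] at b
      omega
    have := grow_aux (fun n => (p n).1) e r (by omega) hrec hp0 hp1
    exact fun K => ⟨K, fun i hi => hi.trans (this i)⟩

theorem descent_aux (u : ℕ → ℕ) (e r : ℕ) (hr : 2 ≤ r) (hu : ∀ n, 0 < u n)
    (h : ∀ n, e * u (n + 1) = u n + r * u (n + 2)) : e = r + 1 := by
  have hD : ∀ n m, (u n * u (n + 2) - u (n + 1) * u (n + 1) : ℤ)
      = r ^ m * (u (n + m) * u (n + m + 2) - u (n + m + 1) * u (n + m + 1)) := by
    intro n m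
    induction m with
    | zero => simp
    | succ m ih =>
      rw [ih]
      have a := h (n + m)
      have b := h (n + m + 1)
      zify at a b
      have e1 : n + (m + 1) = n + m + 1 := by ring
      have e2 : n + m + 1 + 2 = n + m + 3 := by ring
      have e3 : n + m + 1 + 1 = n + m + 2 := by ring
      rw [e1, e2, e3, pow_succ, mul_assoc]
      rw [e2, e3] at b
      congr 1
      linear_combination (u (n + m + 1) : ℤ) * b - (u (n + m + 2) : ℤ) * a
  have hD0 : ∀ n, u n * u (n + 2) = u (n + 1) * u (n + 1) := by
    intro n
    have : (u n * u (n + 2) - u (n + 1) * u (n + 1) : ℤ) = 0 := by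
      set D := (u n * u (n + 2) - u (n + 1) * u (n + 1) : ℤ) with hDdef
      by_contra hne
      have hdvd : (r : ℤ) ^ D.natAbs ∣ D := ⟨_, hD n D.natAbs⟩
      have h1 := Int.natAbs_dvd_natAbs.2 hdvd
      have h2 := Nat.le_of_dvd (by omega) h1
      rw [Int.natAbs_pow, Int.natAbs_natCast] at h2
      have h3 := Nat.lt_pow_self (n := D.natAbs) (show 1 < r by omega)
      omega
    zify
    linarith
  have hdvd : ∀ n, ∃ a, u n = a * u (n + 1) ∧ a * a + r = e * a := by
    intro n
    have key : u n * u n + r * (u (n + 1) * u (n + 1)) = e * u (n + 1) * u n := by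
      rw [h n, ← hD0 n]
      ring
    obtain ⟨a, c, hac, h1, h2⟩ := Nat.exists_coprime (u n) (u (n + 1))
    set g := (u n).gcd (u (n + 1)) with hg
    have hgpos : 0 < g := Nat.gcd_pos_of_pos_left _ (hu n)
    have key2 : a * a + r * (c * c) = e * c * a := by
      rw [h1, h2] at key
      have : (a * a + r * (c * c)) * (g * g) = (e * c * a) * (g * g) := by
        linarith
      exact Nat.eq_of_mul_eq_mul_right (by positivity) this
    have hc : c ∣ a * a := by
      have h5 : c ∣ r * (c * c) := ⟨r * c, by ring⟩
      have h6 : c ∣ a * a + r * (c * c) := by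
        rw [key2]
        exact ⟨e * a, by ring⟩
      exact (Nat.dvd_add_left h5).1 h6
    have hc1 : c = 1 := by
      have : c ∣ a := hac.symm.dvd_of_dvd_mul_left hc
      exact Nat.eq_one_of_dvd_coprimes hac this dvd_rfl
    subst hc1
    refine ⟨a, ?_, by linarith⟩
    rw [h1, h2, one_mul]
  obtain ⟨n, hn⟩ : ∃ n, u n ≤ u (n + 1) := by
    by_contra hcon
    push Not at hcon
    have : ∀ n, u n + n ≤ u 0 := by
      intro n
      induction n with
      | zero => simp
      | succ n ih =>
        have := hcon n
        omega
    have := this (u 0 + 1)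
    omega
  obtain ⟨a, ha1, ha2⟩ := hdvd n
  have hp := hu (n + 1)
  have hp0 := hu n
  have : a = 1 := by
    have : a ≤ 1 := by
      by_contra hc
      push Not at hc
      nlinarith
    have : a ≠ 0 := by
      rintro rfl
      omega
    omega
  subst this
  omega

/-- Theorem A(b): let `(R, m, k)` be a local ring with `m³ = 0 ≠ m²` which is not
Gorenstein (equivalently, `r ≥ 2`).  If there exists a non-zero minimal acyclic complex
`A` (with differentials `d i : A (i+1) → A i`) of finitely generated free `R`-modules,
then `e = r + 1`; in particular `ℓ_R(R) = 2e`. -/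
theorem embdim_eq_socdim_add_one (R : Type) [CommRing R] [IsNoetherianRing R] [IsLocalRing R]
    (h3 : maximalIdeal R ^ 3 = ⊥) (h2 : maximalIdeal R ^ 2 ≠ ⊥)
    (hnotGor : 2 ≤ socdim R)
    (A : ℤ → Type) [∀ i, AddCommGroup (A i)] [∀ i, Module R (A i)]
    (hfree : ∀ i, Module.Free R (A i)) (hfin : ∀ i, Module.Finite R (A i))
    (d : ∀ i : ℤ, A (i + 1) →ₗ[R] A i)
    (hcx : ∀ i, d i ∘ₗ d (i + 1) = 0)
    (hacyclic : ∀ i, LinearMap.range (d (i + 1)) = LinearMap.ker (d i))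
    (hmin : ∀ i, LinearMap.range (d i) ≤ maximalIdeal R • (⊤ : Submodule R (A i)))
    (hnz : ∃ i, Nontrivial (A i)) :
    embdim R = socdim R + 1 ∧ moduleLength R R = 2 * embdim R := by
  have hart : IsArtinianRing R :=
    (isArtinianRing_iff_isNilpotent_maximalIdeal R).2 ⟨3, h3⟩
  unfold socdim embdim at *
  simp only [moduleLength_eq] at *
  obtain ⟨r, hr⟩ := ENat.ne_top_iff_exists.1 (Module.length_ne_top (R := R) (M := socle R))
  have hcf : Module.Finite R (CotangentSpace R) :=
    inferInstanceAs (Module.Finite R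
      (maximalIdeal R ⧸ (maximalIdeal R • ⊤ : Submodule R (maximalIdeal R))))
  obtain ⟨e, he⟩ := ENat.ne_top_iff_exists.1
    (Module.length_ne_top (R := R) (M := CotangentSpace R))
  have hr2 : 2 ≤ r := by
    rw [← hr] at hnotGor
    exact_mod_cast hnotGor
  have hker : ∀ i, LinearMap.ker (d i).rangeRestrict = LinearMap.range (d (i + 1)) := by
    intro i
    rw [LinearMap.ker_rangeRestrict, hacyclic]
  have hsle : ∀ i, socle R • ⊤ ≤ LinearMap.range (d i) := by
    intro i
    obtain ⟨j, rfl⟩ : ∃ j, i = j + 1 := ⟨i - 1, by ring⟩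
    rw [← hker]
    exact socle_le_ker _ (kills_sub _ (hmin j))
  obtain ⟨i0, hi0⟩ := hnz
  -- non-triviality propagates to the left
  have hleft : ∀ i, Nontrivial (A (i + 1)) → Nontrivial (A i) := by
    intro i h
    by_contra hcon
    rw [not_nontrivial_iff_subsingleton] at hcon
    have h1 : (⊤ : Submodule R (A (i + 1))) ≤ maximalIdeal R • ⊤ := by
      refine le_trans ?_ (hmin (i + 1))
      rw [hacyclic]
      intro x _
      exact Subsingleton.elim _ _
    have h4 := Submodule.eq_bot_of_le_smul_of_le_jacobson_bot (maximalIdeal R) _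
      (Module.Finite.fg_top (R := R) (M := A (i + 1))) h1 (IsLocalRing.maximalIdeal_le_jacobson _)
    exact bot_ne_top h4.symm
  have hnt : ∀ n : ℕ, Nontrivial (A (i0 - n)) := by
    intro n
    induction n with
    | zero => simpa using hi0
    | succ n ih =>
      apply hleft
      have : i0 - ((n + 1 : ℕ) : ℤ) + 1 = i0 - n := by push_cast; ring
      rw [this]
      exact ih
  have hfinK : Module.Finite R (ResidueField R) :=
    inferInstanceAs (Module.Finite R (R ⧸ maximalIdeal R))
  obtain ⟨p, hp⟩ := exists_res R (ResidueField R)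
  obtain ⟨N, hN⟩ := betti_grow h3 h2 he.symm hr.symm hr2 hp (Module.finrank R (A i0) + 1)
  have hret : ∀ i, IsRetr R (ResidueField R) (LinearMap.range (d i)) →
      ∀ j : ℕ, ∀ i' : ℤ, i' = i + 1 + j →
        IsRetr R (p j).2 (LinearMap.range (d i')) ∧ (p j).1 ≤ Module.finrank R (A i') := by
    intro i h j
    induction j with
    | zero =>
      intro i' hi'
      obtain rfl : i' = i + 1 := by simpa using hi'
      obtain ⟨f, hf, hf'⟩ := hp.zero
      have := retr_lift (p 0).2.subtype f (LinearMap.range (d (i + 1))).subtype (d i).rangeRestrict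
        (Submodule.subtype_injective _) hf (by simp [hf']) (hf' ▸ hp.min 0)
        (Submodule.subtype_injective _) (LinearMap.surjective_rangeRestrict _)
        (by rw [hker, Submodule.range_subtype]) h
      simpa using this
    | succ j ih =>
      intro i' hi'
      obtain ⟨l, hl⟩ : ∃ l, l = i + 1 + (j : ℤ) := ⟨_, rfl⟩
      obtain rfl : i' = l + 1 := by rw [hi', hl]; push_cast; ring
      obtain ⟨f, hf, hf'⟩ := hp.succ j
      have := retr_lift (p (j + 1)).2.subtype f (LinearMap.range (d (l + 1))).subtype
        (d l).rangeRestrict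
        (Submodule.subtype_injective _) hf (by simp [hf']) (hf' ▸ hp.min _)
        (Submodule.subtype_injective _) (LinearMap.surjective_rangeRestrict _)
        (by rw [hker, Submodule.range_subtype]) (ih l hl).1
      simpa using this
  have hnoret : ∀ i, i ≤ i0 - 1 - N → ¬ IsRetr R (ResidueField R) (LinearMap.range (d i)) := by
    intro i hi h
    obtain ⟨j, hj⟩ := Int.eq_ofNat_of_zero_le (show 0 ≤ i0 - (i + 1) by omega)
    have a := (hret i h j i0 (by omega)).2
    have b := hN j (by omega)
    omega
  have hall := fun i hi => smul_eq_of_not_retr h3 _ (hsle i) (hmin i) (hnoret i hi)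
  have hsoc : socle R = maximalIdeal R ^ 2 := by
    have hh := hall (i0 - ((1 + N : ℕ) : ℤ)) (by push_cast; omega)
    have := hnt (1 + N)
    refine socle_eq_sq h3 (F := A (i0 - ((1 + N : ℕ) : ℤ))) ?_
    rw [← hh.1]
    exact hh.2
  let b : ℤ → ℕ := fun i => Module.finrank R (A i)
  have hrec : ∀ i, i + 1 ≤ i0 - 1 - N → e * b (i + 1) = b (i + 1 + 1) + r * b i := by
    intro i hi
    exact recurrence he.symm hr.symm hsoc (LinearMap.range (d i)) (d i).rangeRestrict
      (LinearMap.surjective_rangeRestrict _) (LinearMap.range (d (i + 1))) (hker i) (hmin _)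
      (d (i + 1)).rangeRestrict (LinearMap.surjective_rangeRestrict _)
      (by rw [hker]; exact hmin _) (hall i (by omega)).1 (hall (i + 1) hi).1
  have her : e = r + 1 := by
    refine descent_aux (fun n => b (i0 - N - n)) e r hr2 ?_ ?_
    · intro n
      have := hnt (N + n)
      have h5 : i0 - ((N + n : ℕ) : ℤ) = i0 - N - n := by push_cast; ring
      rw [h5] at this
      exact Module.finrank_pos_iff_of_free R _ |>.2 this
    · intro n
      have := hrec (i0 - N - n - 2) (by omega)
      have e1 : i0 - N - n - 2 + 1 = i0 - N - ((n + 1 : ℕ) : ℤ) := by push_cast; ring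
      have e2 : i0 - N - n - 2 = i0 - N - ((n + 2 : ℕ) : ℤ) := by push_cast; ring
      have e3 : i0 - N - ((n + 1 : ℕ) : ℤ) + 1 = i0 - N - (n : ℤ) := by push_cast; ring
      rw [e1, e3, e2] at this
      exact this
  rw [len_R', ← hsoc, ← hr, ← he, her]
  norm_cast
  exact ⟨rfl, by ring⟩
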